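/- arXiv:2304.09437 — 6 statements merged into one kernel-verified Lean document; each statement's English description precedes it below -/
import Mathlib

section
/- Let A be the 8×8 real matrix with rows (-1,0,0,1,0,0,0,1), (0,-1,0,0,1,0,0,1), (0,0,-1,0,0,1,0,1), (1,0,0,-1,0,0,1,0), (0,1,0,0,-1,0,1,0), (0,0,1,0,0,-1,1,0), (0,0,0,1,1,1,-1,0), (1,1,1,0,0,0,0,-2). Define P : ℝ → ℝ^8 by P(u) = (0,0,0,1,1,1,2,-u) for 0 ≤ u ≤ 1 and P(u) = (1-u,1-u,1-u,1,1,1,2,-u) for 1 ≤ u ≤ 2. Then (1/5)·∫_0^2 P(u)ᵀ A P(u) du = 17/15. -/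
open Matrix MeasureTheory intervalIntegral

theorem stmt_0 (A : Matrix (Fin 8) (Fin 8) ℝ)
    (hA : A = !![-1, 0, 0, 1, 0, 0, 0, 1;
        0, -1, 0, 0, 1, 0, 0, 1;
        0, 0, -1, 0, 0, 1, 0, 1;
        1, 0, 0, -1, 0, 0, 1, 0;
        0, 1, 0, 0, -1, 0, 1, 0;
        0, 0, 1, 0, 0, -1, 1, 0;
        0, 0, 0, 1, 1, 1, -1, 0;
        1, 1, 1, 0, 0, 0, 0, -2])
    (P : ℝ → Fin 8 → ℝ)
    (hP1 : ∀ u : ℝ, (0 : ℝ) ≤ u → u ≤ (1 : ℝ) → P u = ![0, 0, 0, 1, 1, 1, 2, -u])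
    (hP2 : ∀ u : ℝ, (1 : ℝ) ≤ u → u ≤ (2 : ℝ) → P u = ![1-u, 1-u, 1-u, 1, 1, 1, 2, -u])
    : (1/5 : ℝ) * ∫ u in (0:ℝ)..(2:ℝ), P u ⬝ᵥ (A *ᵥ P u) = 17/15 := by
  have h₁ : Set.EqOn (fun u => P u ⬝ᵥ (A *ᵥ P u)) (fun u => 5 - 2 * u ^ 2)
      (Set.uIcc 0 1) := by
    intro u hu
    rw [Set.uIcc_of_le zero_le_one] at hu
    simp only [hP1 u hu.1 hu.2, hA, dotProduct, mulVec, Fin.sum_univ_eight]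
    simp
    ring
  have h₂ : Set.EqOn (fun u => P u ⬝ᵥ (A *ᵥ P u)) (fun u => 5 - 2 * u ^ 2 + 3 * (1 - u) ^ 2)
      (Set.uIcc 1 2) := by
    intro u hu
    rw [Set.uIcc_of_le one_le_two] at hu
    simp only [hP2 u hu.1 hu.2, hA, dotProduct, mulVec, Fin.sum_univ_eight]
    simp
    ring
  have i₁ : IntervalIntegrable (fun u => P u ⬝ᵥ (A *ᵥ P u)) volume 0 1 :=
    (ContinuousOn.congr (by fun_prop) h₁).intervalIntegrable
  have i₂ : IntervalIntegrable (fun u => P u ⬝ᵥ (A *ᵥ P u)) volume 1 2 :=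
    (ContinuousOn.congr (by fun_prop) h₂).intervalIntegrable
  have e₁ : ∫ u in (0 : ℝ)..1, (5 - 2 * u ^ 2) = 13 / 3 := by
    rw [integral_sub (Continuous.intervalIntegrable (by fun_prop) _ _)
      (Continuous.intervalIntegrable (by fun_prop) _ _)]
    norm_num [integral_pow]
  have e₂ : ∫ u in (1 : ℝ)..2, (5 - 2 * u ^ 2 + 3 * (1 - u) ^ 2) = 4 / 3 := by
    have h : ∀ u : ℝ, 5 - 2 * u ^ 2 + 3 * (1 - u) ^ 2 = u ^ 2 - 6 * u + 8 := fun u => by ring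
    simp only [h]
    rw [integral_add (Continuous.intervalIntegrable (by fun_prop) _ _)
      (Continuous.intervalIntegrable (by fun_prop) _ _),
      integral_sub (Continuous.intervalIntegrable (by fun_prop) _ _)
      (Continuous.intervalIntegrable (by fun_prop) _ _)]
    rw [intervalIntegral.integral_const_mul]
    norm_num [integral_pow, integral_id]
  rw [← integral_add_adjacent_intervals i₁ i₂, integral_congr h₁, integral_congr h₂, e₁, e₂]
  norm_num
end

section
/- Let A be the 7×7 real matrix with rows (-1,0,0,0,0,1,1), (0,-1,1,0,0,1,0), (0,1,-1,1,0,0,0), (0,0,1,-1,1,0,0), (0,0,0,1,-1,0,1), (1,1,0,0,0,-2,0), (1,0,0,0,1,0,-2). Define P : ℝ → ℝ^7 by P(u) = (1-u,1,1,1,1,1-u/2,1-u/2) for 0 ≤ u ≤ 2 and P(u) = (1-u,3-u,1,1,3-u,2-u,2-u) for 2 ≤ u ≤ 3. Then (1/5)·∫_0^3 P(u)ᵀ A P(u) du = 19/15. -/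
open Matrix MeasureTheory intervalIntegral

theorem stmt_4 (A : Matrix (Fin 7) (Fin 7) ℝ)
    (hA : A = !![-1, 0, 0, 0, 0, 1, 1;
        0, -1, 1, 0, 0, 1, 0;
        0, 1, -1, 1, 0, 0, 0;
        0, 0, 1, -1, 1, 0, 0;
        0, 0, 0, 1, -1, 0, 1;
        1, 1, 0, 0, 0, -2, 0;
        1, 0, 0, 0, 1, 0, -2])
    (P : ℝ → Fin 7 → ℝ)
    (hP1 : ∀ u : ℝ, (0 : ℝ) ≤ u → u ≤ (2 : ℝ) → P u = ![1-u, 1, 1, 1, 1, 1-u/2, 1-u/2])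
    (hP2 : ∀ u : ℝ, (2 : ℝ) ≤ u → u ≤ (3 : ℝ) → P u = ![1-u, 3-u, 1, 1, 3-u, 2-u, 2-u])
    : (1/5 : ℝ) * ∫ u in (0:ℝ)..(3:ℝ), P u ⬝ᵥ (A *ᵥ P u) = 19/15 := by
  have quad₁ : ∀ u ∈ Set.uIcc (0 : ℝ) 2, P u ⬝ᵥ (A *ᵥ P u) = 5 - 2 * u := by
    intro u hu
    rw [Set.uIcc_of_le (by norm_num)] at hu
    rw [hP1 u hu.1 hu.2, hA]
    simp [dotProduct, mulVec, Fin.sum_univ_succ]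
    ring
  have quad₂ : ∀ u ∈ Set.uIcc (2 : ℝ) 3, P u ⬝ᵥ (A *ᵥ P u) = (3 - u) ^ 2 := by
    intro u hu
    rw [Set.uIcc_of_le (by norm_num)] at hu
    rw [hP2 u hu.1 hu.2, hA]
    simp [dotProduct, mulVec, Fin.sum_univ_succ]
    ring
  have int₁ : IntervalIntegrable (fun u => P u ⬝ᵥ (A *ᵥ P u)) volume 0 2 :=
    ContinuousOn.intervalIntegrable
      ((by fun_prop : Continuous fun u : ℝ => 5 - 2 * u).continuousOn.congr quad₁)
  have int₂ : IntervalIntegrable (fun u => P u ⬝ᵥ (A *ᵥ P u)) volume 2 3 :=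
    ContinuousOn.intervalIntegrable
      ((by fun_prop : Continuous fun u : ℝ => (3 - u) ^ 2).continuousOn.congr quad₂)
  have val₁ : ∫ u in (0 : ℝ)..2, (5 - 2 * u) = 6 := by
    rw [integral_sub (by simp) (Continuous.intervalIntegrable (by fun_prop) _ _),
      intervalIntegral.integral_const_mul, integral_id]
    norm_num
  have val₂ : ∫ u in (2 : ℝ)..3, (3 - u) ^ 2 = 1 / 3 := by
    rw [integral_comp_sub_left (fun x : ℝ => x ^ 2), integral_pow]
    norm_num
  rw [← integral_add_adjacent_intervals int₁ int₂, integral_congr quad₁, integral_congr quad₂,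
    val₁, val₂]
  norm_num
end

section
/- Let A be the 6×6 real matrix with rows (-1,1,0,0,0,0), (1,-1,0,1,0,0), (0,0,-1,0,1,1), (0,1,0,-2,1,0), (0,0,1,1,-2,0), (0,0,1,0,0,-2). Define P : ℝ → ℝ^6 by P(u) = (2,3,0,2-u/2,1-u,0) for 0 ≤ u ≤ 1, P(u) = (2,3,2-2u,2-u/2,1-u,1-u) for 1 ≤ u ≤ 2, and P(u) = (2,5-u,2-2u,3-u,1-u,1-u) for 2 ≤ u ≤ 3. Then (1/5)·∫_0^3 P(u)ᵀ A P(u) du = 7/5. -/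
open Matrix MeasureTheory intervalIntegral

theorem integral_quadratic (a b c p q : ℝ) : ∫ u in p..q, (a + b * u + c * u ^ 2) =
    a * (q - p) + b * ((q ^ 2 - p ^ 2) / 2) + c * ((q ^ 3 - p ^ 3) / 3) := by
  rw [integral_add (Continuous.intervalIntegrable (by fun_prop) _ _)
      (Continuous.intervalIntegrable (by fun_prop) _ _),
    integral_add (Continuous.intervalIntegrable (by fun_prop) _ _)
      (Continuous.intervalIntegrable (by fun_prop) _ _),
    intervalIntegral.integral_const, intervalIntegral.integral_const_mul,
    intervalIntegral.integral_const_mul, integral_id, integral_pow, smul_eq_mul]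
  push_cast
  ring

theorem stmt_6 (A : Matrix (Fin 6) (Fin 6) ℝ)
    (hA : A = !![-1, 1, 0, 0, 0, 0;
        1, -1, 0, 1, 0, 0;
        0, 0, -1, 0, 1, 1;
        0, 1, 0, -2, 1, 0;
        0, 0, 1, 1, -2, 0;
        0, 0, 1, 0, 0, -2])
    (P : ℝ → Fin 6 → ℝ)
    (hP1 : ∀ u : ℝ, (0 : ℝ) ≤ u → u ≤ (1 : ℝ) → P u = ![2, 3, 0, 2-u/2, 1-u, 0])
    (hP2 : ∀ u : ℝ, (1 : ℝ) ≤ u → u ≤ (2 : ℝ) → P u = ![2, 3, 2-2*u, 2-u/2, 1-u, 1-u])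
    (hP3 : ∀ u : ℝ, (2 : ℝ) ≤ u → u ≤ (3 : ℝ) → P u = ![2, 5-u, 2-2*u, 3-u, 1-u, 1-u])
    : (1/5 : ℝ) * ∫ u in (0:ℝ)..(3:ℝ), P u ⬝ᵥ (A *ᵥ P u) = 7/5 := by
  have quad (v : Fin 6 → ℝ) : v ⬝ᵥ (A *ᵥ v) =
      -v 0 ^ 2 - v 1 ^ 2 - v 2 ^ 2 - 2 * v 3 ^ 2 - 2 * v 4 ^ 2 - 2 * v 5 ^ 2
        + 2 * (v 0 * v 1 + v 1 * v 3 + v 2 * v 4 + v 2 * v 5 + v 3 * v 4) := by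
    subst hA
    simp [dotProduct, mulVec, Fin.sum_univ_six]
    ring
  have eq1 : Set.EqOn (fun u ↦ 5 + 0 * u + (-3 / 2) * u ^ 2) (fun u ↦ P u ⬝ᵥ (A *ᵥ P u))
      (Set.uIcc 0 1) := by
    intro u hu
    rw [Set.uIcc_of_le (by norm_num)] at hu
    simp [quad, hP1 u hu.1 hu.2]
    ring
  have eq2 : Set.EqOn (fun u ↦ 7 + (-4) * u + 1 / 2 * u ^ 2) (fun u ↦ P u ⬝ᵥ (A *ᵥ P u))
      (Set.uIcc 1 2) := by
    intro u hu
    rw [Set.uIcc_of_le (by norm_num)] at hu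
    simp [quad, hP2 u hu.1 hu.2]
    ring
  have eq3 : Set.EqOn (fun u ↦ 9 + (-6) * u + 1 * u ^ 2) (fun u ↦ P u ⬝ᵥ (A *ᵥ P u))
      (Set.uIcc 2 3) := by
    intro u hu
    rw [Set.uIcc_of_le (by norm_num)] at hu
    simp [quad, hP3 u hu.1 hu.2]
    ring
  have int1 : IntervalIntegrable (fun u ↦ P u ⬝ᵥ (A *ᵥ P u)) volume 0 1 :=
    (ContinuousOn.congr (by fun_prop) eq1.symm).intervalIntegrable
  have int2 : IntervalIntegrable (fun u ↦ P u ⬝ᵥ (A *ᵥ P u)) volume 1 2 :=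
    (ContinuousOn.congr (by fun_prop) eq2.symm).intervalIntegrable
  have int3 : IntervalIntegrable (fun u ↦ P u ⬝ᵥ (A *ᵥ P u)) volume 2 3 :=
    (ContinuousOn.congr (by fun_prop) eq3.symm).intervalIntegrable
  rw [← integral_add_adjacent_intervals (int1.trans int2) int3,
    ← integral_add_adjacent_intervals int1 int2, ← integral_congr eq1, ← integral_congr eq2,
    ← integral_congr eq3,
    integral_quadratic, integral_quadratic, integral_quadratic]
  norm_num
end

section
/- Let A be the 6×6 real matrix with rows (-1,1,0,0,0,0), (1,-1,0,0,1,0), (0,0,-1,0,0,1), (0,0,0,-1,0,1), (0,1,0,0,-2,1), (0,0,1,1,1,-2). Define P : ℝ → ℝ^6 by P(u) = (2,3,-u,0,2-u/3,1-2u/3) for 0 ≤ u ≤ 3/2 and P(u) = (2,3,-u,3-2u,3-u,3-2u) for 3/2 ≤ u ≤ 2. Then (1/5)·∫_0^2 P(u)ᵀ A P(u) du = 31/30. -/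
open Matrix MeasureTheory intervalIntegral

theorem stmt_8 (A : Matrix (Fin 6) (Fin 6) ℝ)
    (hA : A = !![-1, 1, 0, 0, 0, 0;
        1, -1, 0, 0, 1, 0;
        0, 0, -1, 0, 0, 1;
        0, 0, 0, -1, 0, 1;
        0, 1, 0, 0, -2, 1;
        0, 0, 1, 1, 1, -2])
    (P : ℝ → Fin 6 → ℝ)
    (hP1 : ∀ u : ℝ, (0 : ℝ) ≤ u → u ≤ (3/2 : ℝ) → P u = ![2, 3, -u, 0, 2-u/3, 1-2*u/3])
    (hP2 : ∀ u : ℝ, (3/2 : ℝ) ≤ u → u ≤ (2 : ℝ) → P u = ![2, 3, -u, 3-2*u, 3-u, 3-2*u])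
    : (1/5 : ℝ) * ∫ u in (0:ℝ)..(2:ℝ), P u ⬝ᵥ (A *ᵥ P u) = 31/30 := by
  have h1 : Set.EqOn (fun u => P u ⬝ᵥ (A *ᵥ P u)) (fun u => 5 - 2 * u - u ^ 2 / 3)
      (Set.uIcc (0 : ℝ) (3 / 2)) := by
    intro u hu
    rw [Set.uIcc_of_le (by norm_num)] at hu
    simp only [hP1 u hu.1 hu.2, hA, dotProduct, mulVec, Fin.sum_univ_six]
    simp
    ring
  have h2 : Set.EqOn (fun u => P u ⬝ᵥ (A *ᵥ P u)) (fun u => 8 - 6 * u + u ^ 2)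
      (Set.uIcc (3 / 2 : ℝ) 2) := by
    intro u hu
    rw [Set.uIcc_of_le (by norm_num)] at hu
    simp only [hP2 u hu.1 hu.2, hA, dotProduct, mulVec, Fin.sum_univ_six]
    simp
    ring
  have hi1 : IntervalIntegrable (fun u => P u ⬝ᵥ (A *ᵥ P u)) volume 0 (3 / 2) :=
    (ContinuousOn.congr (by fun_prop) h1).intervalIntegrable
  have hi2 : IntervalIntegrable (fun u => P u ⬝ᵥ (A *ᵥ P u)) volume (3 / 2) 2 :=
    (ContinuousOn.congr (by fun_prop) h2).intervalIntegrable
  have e1 : ∫ u in (0 : ℝ)..(3 / 2), (5 - 2 * u - u ^ 2 / 3) = 39 / 8 := by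
    rw [integral_sub (Continuous.intervalIntegrable (by fun_prop) _ _)
        (Continuous.intervalIntegrable (by fun_prop) _ _),
      integral_sub (Continuous.intervalIntegrable (by fun_prop) _ _)
        (Continuous.intervalIntegrable (by fun_prop) _ _),
      intervalIntegral.integral_const_mul]
    simp
    norm_num
  have e2 : ∫ u in (3 / 2 : ℝ)..2, (8 - 6 * u + u ^ 2) = 7 / 24 := by
    rw [integral_add (Continuous.intervalIntegrable (by fun_prop) _ _)
        (Continuous.intervalIntegrable (by fun_prop) _ _),
      integral_sub (Continuous.intervalIntegrable (by fun_prop) _ _)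
        (Continuous.intervalIntegrable (by fun_prop) _ _),
      intervalIntegral.integral_const_mul]
    simp
    norm_num
  rw [← integral_add_adjacent_intervals hi1 hi2, integral_congr h1, integral_congr h2, e1, e2]
  norm_num
end

section
/- Let A be the 5×5 real matrix with rows (-1,0,0,1,0), (0,-2,1,0,0), (0,1,-2,1,0), (1,0,1,-2,1), (0,0,0,1,-2). Define P : ℝ → ℝ^5 by P(u) = (5,2-u/2,4-u,6-2u/3,3-u/3) for 0 ≤ u ≤ 3/2 and P(u) = (8-2u,2-u/2,4-u,8-2u,4-u) for 3/2 ≤ u ≤ 4. Then (1/5)·∫_0^4 P(u)ᵀ A P(u) du = 11/6. -/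
open Matrix MeasureTheory intervalIntegral

theorem stmt_12 (A : Matrix (Fin 5) (Fin 5) ℝ)
    (hA : A = !![-1, 0, 0, 1, 0;
        0, -2, 1, 0, 0;
        0, 1, -2, 1, 0;
        1, 0, 1, -2, 1;
        0, 0, 0, 1, -2])
    (P : ℝ → Fin 5 → ℝ)
    (hP1 : ∀ u : ℝ, (0 : ℝ) ≤ u → u ≤ (3/2 : ℝ) → P u = ![5, 2-u/2, 4-u, 6-2*u/3, 3-u/3])
    (hP2 : ∀ u : ℝ, (3/2 : ℝ) ≤ u → u ≤ (4 : ℝ) → P u = ![8-2*u, 2-u/2, 4-u, 8-2*u, 4-u])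
    : (1/5 : ℝ) * ∫ u in (0:ℝ)..(4:ℝ), P u ⬝ᵥ (A *ᵥ P u) = 11/6 := by
  have h₁ : Set.EqOn (fun u ↦ P u ⬝ᵥ (A *ᵥ P u)) (fun u ↦ 5 - 5 / 6 * u ^ 2) (Set.uIcc 0 (3 / 2)) := by
    intro u hu
    rw [Set.uIcc_of_le (by norm_num)] at hu
    simp only [hP1 u hu.1 hu.2, hA, mulVec, dotProduct, Fin.sum_univ_five, of_apply, cons_val]
    ring
  have h₂ : Set.EqOn (fun u ↦ P u ⬝ᵥ (A *ᵥ P u)) (fun u ↦ 1 / 2 * (4 - u) ^ 2)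
      (Set.uIcc (3 / 2) 4) := by
    intro u hu
    rw [Set.uIcc_of_le (by norm_num)] at hu
    simp only [hP2 u hu.1 hu.2, hA, mulVec, dotProduct, Fin.sum_univ_five, of_apply, cons_val]
    ring
  have i₁ : IntervalIntegrable (fun u ↦ P u ⬝ᵥ (A *ᵥ P u)) volume 0 (3 / 2) :=
    ContinuousOn.intervalIntegrable (ContinuousOn.congr (by fun_prop) h₁)
  have i₂ : IntervalIntegrable (fun u ↦ P u ⬝ᵥ (A *ᵥ P u)) volume (3 / 2) 4 :=
    ContinuousOn.intervalIntegrable (ContinuousOn.congr (by fun_prop) h₂)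
  rw [← integral_add_adjacent_intervals i₁ i₂, integral_congr h₁, integral_congr h₂,
    intervalIntegral.integral_sub (by simp) (Continuous.intervalIntegrable (by fun_prop) _ _),
    intervalIntegral.integral_const_mul, intervalIntegral.integral_const_mul,
    integral_comp_sub_left (fun u : ℝ ↦ u ^ 2) 4]
  simp only [intervalIntegral.integral_const, integral_pow, smul_eq_mul]
  norm_num
end

section
/- Let A be the 4×4 real matrix with rows (-1,0,0,1), (0,-1,0,1), (0,0,-1,1), (1,1,1,-2). Define P : ℝ → ℝ^4 by P(u) = (2,2,2,3-u) for 0 ≤ u ≤ 1 and P(u) = (3-u,3-u,3-u,3-u) for 1 ≤ u ≤ 3. Then (1/6)·∫_0^3 P(u)ᵀ A P(u) du = 4/3. -/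
open Matrix MeasureTheory intervalIntegral

theorem stmt_14 (A : Matrix (Fin 4) (Fin 4) ℝ)
    (hA : A = !![-1, 0, 0, 1;
        0, -1, 0, 1;
        0, 0, -1, 1;
        1, 1, 1, -2])
    (P : ℝ → Fin 4 → ℝ)
    (hP1 : ∀ u : ℝ, (0 : ℝ) ≤ u → u ≤ (1 : ℝ) → P u = ![2, 2, 2, 3-u])
    (hP2 : ∀ u : ℝ, (1 : ℝ) ≤ u → u ≤ (3 : ℝ) → P u = ![3-u, 3-u, 3-u, 3-u])
    : (1/6 : ℝ) * ∫ u in (0:ℝ)..(3:ℝ), P u ⬝ᵥ (A *ᵥ P u) = 4/3 := by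
  have h₁ : Set.EqOn (fun u => P u ⬝ᵥ (A *ᵥ P u)) (fun u => 6 - 2 * u ^ 2) (Set.uIcc 0 1) := by
    intro u hu
    rw [Set.uIcc_of_le zero_le_one] at hu
    simp only [hP1 u hu.1 hu.2, hA, dotProduct, mulVec, Fin.sum_univ_four, of_apply, cons_val]
    ring
  have h₂ : Set.EqOn (fun u => P u ⬝ᵥ (A *ᵥ P u)) (fun u => (3 - u) ^ 2) (Set.uIcc 1 3) := by
    intro u hu
    rw [Set.uIcc_of_le (by norm_num)] at hu
    simp only [hP2 u hu.1 hu.2, hA, dotProduct, mulVec, Fin.sum_univ_four, of_apply, cons_val]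
    ring
  have hi₁ : IntervalIntegrable (fun u => P u ⬝ᵥ (A *ᵥ P u)) volume 0 1 :=
    (ContinuousOn.congr (by fun_prop) h₁).intervalIntegrable
  have hi₂ : IntervalIntegrable (fun u => P u ⬝ᵥ (A *ᵥ P u)) volume 1 3 :=
    (ContinuousOn.congr (by fun_prop) h₂).intervalIntegrable
  have e₁ : ∫ u in (0:ℝ)..1, (6 - 2 * u ^ 2) = 16 / 3 := by
    rw [integral_sub (by simp) (Continuous.intervalIntegrable (by fun_prop) _ _),
      intervalIntegral.integral_const_mul, integral_pow]
    norm_num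
  have e₂ : ∫ u in (1:ℝ)..3, (3 - u) ^ 2 = 8 / 3 := by
    rw [integral_comp_sub_left (fun u => u ^ 2) 3, integral_pow]
    norm_num
  rw [← integral_add_adjacent_intervals hi₁ hi₂, integral_congr h₁, integral_congr h₂, e₁, e₂]
  norm_num
end
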